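/- Correctness of the dynamic programming recursion over midpoint thresholds (Eqs. 4–6): for every dataset D and every depth limit d ≥ 1, the optimal misclassification score satisfies θ(D, d) = min of the set {L(D)} ∪ {θ(D(f ≤ τ), d−1) + θ(D(f > τ), d−1) : f : Fin p, τ ∈ S^f}, where L(D) := min over ŷ : Y of Σ_{(x,y) ∈ D} (if y = ŷ then 0 else 1) is the best leaf score. In particular, restricting split thresholds to the finite sets S^f of midpoints loses no optimality. -/

import Mathlib

open scoped Classical

/-- A binary axis-aligned decision tree over `p` features with labels in `Y`:
either a leaf carrying a label, or a node carrying a feature, a threshold,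
and two subtrees. -/
inductive DTree (p : ℕ) (Y : Type) : Type
  | leaf (lab : Y) : DTree p Y
  | node (f : Fin p) (τ : ℝ) (l r : DTree p Y) : DTree p Y

namespace DTree

/-- A leaf classifies every `x` as its label; a node classifies `x` by the left
subtree if `x f ≤ τ` and by the right subtree otherwise. -/
noncomputable def classify {p : ℕ} {Y : Type} : DTree p Y → (Fin p → ℝ) → Y
  | leaf lab, _ => lab
  | node f τ l r, x => if x f ≤ τ then l.classify x else r.classify x

/-- The depth of a leaf is 0; the depth of a node is 1 plus the maximum of the
depths of its subtrees. -/
def depth {p : ℕ} {Y : Type} : DTree p Y → ℕ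
  | leaf _ => 0
  | node _ _ l r => 1 + max l.depth r.depth

end DTree

/-- `errors t D` is the number of observations of `D` misclassified by `t`. -/
noncomputable def errors {p : ℕ} {Y : Type} (t : DTree p Y)
    (D : Multiset ((Fin p → ℝ) × Y)) : ℕ :=
  (D.map fun xy => if t.classify xy.1 = xy.2 then 0 else 1).sum

/-- `theta D d`: the optimal misclassification score, i.e. the minimum of
`errors t D` over all decision trees `t` of depth at most `d`. -/
noncomputable def theta {p : ℕ} {Y : Type} (D : Multiset ((Fin p → ℝ) × Y))
    (d : ℕ) : ℕ :=
  sInf {n | ∃ t : DTree p Y, t.depth ≤ d ∧ errors t D = n}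

/-- `dle D f τ = D(f ≤ τ)`: the sub-multiset of observations with `x f ≤ τ`. -/
noncomputable def dle {p : ℕ} {Y : Type} (D : Multiset ((Fin p → ℝ) × Y))
    (f : Fin p) (τ : ℝ) : Multiset ((Fin p → ℝ) × Y) :=
  D.filter fun xy => xy.1 f ≤ τ

/-- `dgt D f τ = D(f > τ)`: the sub-multiset of observations with `x f > τ`. -/
noncomputable def dgt {p : ℕ} {Y : Type} (D : Multiset ((Fin p → ℝ) × Y))
    (f : Fin p) (τ : ℝ) : Multiset ((Fin p → ℝ) × Y) :=
  D.filter fun xy => τ < xy.1 f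

/-- `zf D f τ = z_f(τ) := card(D(f ≤ τ))`. -/
noncomputable def zf {p : ℕ} {Y : Type} (D : Multiset ((Fin p → ℝ) × Y))
    (f : Fin p) (τ : ℝ) : ℕ :=
  (dle D f τ).card

/-- `splitScore D d f τ = Split(D, d, f, τ) := θ(D(f ≤ τ), d−1) + θ(D(f > τ), d−1)`. -/
noncomputable def splitScore {p : ℕ} {Y : Type} (D : Multiset ((Fin p → ℝ) × Y))
    (d : ℕ) (f : Fin p) (τ : ℝ) : ℕ :=
  theta (dle D f τ) (d - 1) + theta (dgt D f τ) (d - 1)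

/-- The multiset of values of feature `f` in `D`. -/
noncomputable def featureVals {p : ℕ} {Y : Type} (D : Multiset ((Fin p → ℝ) × Y))
    (f : Fin p) : Multiset ℝ :=
  D.map fun xy => xy.1 f

/-- `midpoints D f = S^f`: the set of midpoints `(a + b) / 2` over all pairs
`a < b` of consecutive distinct values of feature `f` in `D` (i.e. no feature
value lies strictly between `a` and `b`). -/
noncomputable def midpoints {p : ℕ} {Y : Type} (D : Multiset ((Fin p → ℝ) × Y))
    (f : Fin p) : Set ℝ :=
  {m | ∃ a b : ℝ, a ∈ featureVals D f ∧ b ∈ featureVals D f ∧ a < b ∧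
    (∀ c ∈ featureVals D f, ¬(a < c ∧ c < b)) ∧ m = (a + b) / 2}

/-- `leafScore D = L(D)`: the best leaf score, the minimum over labels `ŷ` of
the number of observations of `D` whose label differs from `ŷ`. -/
noncomputable def leafScore {p : ℕ} {Y : Type} (D : Multiset ((Fin p → ℝ) × Y)) : ℕ :=
  sInf {n | ∃ lab : Y, n = (D.map fun xy => if xy.2 = lab then 0 else 1).sum}

section

variable {p : ℕ} {Y : Type}

lemma theta_le_errors {D : Multiset ((Fin p → ℝ) × Y)} {d : ℕ} {t : DTree p Y}
    (ht : t.depth ≤ d) : theta D d ≤ errors t D :=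
  Nat.sInf_le ⟨t, ht, rfl⟩

lemma exists_errors_eq_theta [Nonempty Y] (D : Multiset ((Fin p → ℝ) × Y)) (d : ℕ) :
    ∃ t : DTree p Y, t.depth ≤ d ∧ errors t D = theta D d := by
  have hne : {n | ∃ t : DTree p Y, t.depth ≤ d ∧ errors t D = n}.Nonempty :=
    ⟨_, DTree.leaf (Classical.arbitrary Y), Nat.zero_le _, rfl⟩
  exact Nat.sInf_mem hne

lemma errors_leaf (lab : Y) (D : Multiset ((Fin p → ℝ) × Y)) :
    errors (DTree.leaf lab) D = (D.map fun xy => if xy.2 = lab then 0 else 1).sum := by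
  refine congrArg Multiset.sum (Multiset.map_congr rfl fun xy _ => ?_)
  exact if_congr eq_comm rfl rfl

lemma leafScore_le_errors_leaf (lab : Y) (D : Multiset ((Fin p → ℝ) × Y)) :
    leafScore D ≤ errors (DTree.leaf lab) D :=
  Nat.sInf_le ⟨lab, errors_leaf lab D⟩

lemma exists_errors_leaf_eq_leafScore [Nonempty Y] (D : Multiset ((Fin p → ℝ) × Y)) :
    ∃ lab : Y, errors (DTree.leaf lab) D = leafScore D := by
  have hne : {n | ∃ lab : Y,
      n = (D.map fun xy => if xy.2 = lab then 0 else 1).sum}.Nonempty :=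
    ⟨_, Classical.arbitrary Y, rfl⟩
  obtain ⟨lab, h⟩ := Nat.sInf_mem hne
  exact ⟨lab, (errors_leaf lab D).trans h.symm⟩

lemma errors_cons (t : DTree p Y) (a : (Fin p → ℝ) × Y) (D : Multiset ((Fin p → ℝ) × Y)) :
    errors t (a ::ₘ D) = (if t.classify a.1 = a.2 then 0 else 1) + errors t D := by
  simp [errors]

lemma errors_node (f : Fin p) (τ : ℝ) (l r : DTree p Y) (D : Multiset ((Fin p → ℝ) × Y)) :
    errors (DTree.node f τ l r) D = errors l (dle D f τ) + errors r (dgt D f τ) := by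
  induction D using Multiset.induction_on with
  | empty => simp [errors, dle, dgt]
  | cons a D ih =>
    rw [errors_cons, ih]
    by_cases h : a.1 f ≤ τ
    · have hclass : (DTree.node f τ l r).classify a.1 = l.classify a.1 := if_pos h
      rw [hclass, show dle (a ::ₘ D) f τ = a ::ₘ dle D f τ from Multiset.filter_cons_of_pos _ h,
        show dgt (a ::ₘ D) f τ = dgt D f τ from Multiset.filter_cons_of_neg _ (not_lt.2 h),
        errors_cons, add_assoc]
    · have hclass : (DTree.node f τ l r).classify a.1 = r.classify a.1 := if_neg h
      rw [hclass, show dle (a ::ₘ D) f τ = dle D f τ from Multiset.filter_cons_of_neg _ h,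
        show dgt (a ::ₘ D) f τ = a ::ₘ dgt D f τ from
          Multiset.filter_cons_of_pos _ (not_le.1 h),
        errors_cons, add_left_comm]

/-- A threshold with observations on both sides induces the same split as some midpoint. -/
lemma exists_midpoint_split_eq {D : Multiset ((Fin p → ℝ) × Y)} {f : Fin p} {τ : ℝ}
    (hle : ∃ xy ∈ D, xy.1 f ≤ τ) (hgt : ∃ xy ∈ D, τ < xy.1 f) :
    ∃ m ∈ midpoints D f, dle D f m = dle D f τ ∧ dgt D f m = dgt D f τ := by
  obtain ⟨u, hu, hmax⟩ := (dle D f τ).toFinset.exists_max_image (fun xy => xy.1 f) <| by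
    obtain ⟨xy, h, h'⟩ := hle
    exact ⟨xy, by simp [dle, h, h']⟩
  obtain ⟨v, hv, hmin⟩ := (dgt D f τ).toFinset.exists_min_image (fun xy => xy.1 f) <| by
    obtain ⟨xy, h, h'⟩ := hgt
    exact ⟨xy, by simp [dgt, h, h']⟩
  simp only [dle, dgt, Multiset.mem_toFinset, Multiset.mem_filter] at hu hv hmax hmin
  have hside : ∀ xy ∈ D, xy.1 f ≤ (u.1 f + v.1 f) / 2 ↔ xy.1 f ≤ τ := by
    intro xy hxy
    rcases le_or_gt (xy.1 f) τ with h | h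
    · have := hmax xy ⟨hxy, h⟩
      exact ⟨fun _ => h, fun _ => by linarith⟩
    · have := hmin xy ⟨hxy, h⟩
      exact ⟨fun _ => by linarith, fun _ => by linarith⟩
  refine ⟨(u.1 f + v.1 f) / 2, ⟨u.1 f, v.1 f, Multiset.mem_map_of_mem _ hu.1,
    Multiset.mem_map_of_mem _ hv.1, by linarith, ?_, rfl⟩,
    Multiset.filter_congr hside, Multiset.filter_congr fun xy hxy => ?_⟩
  · intro c hc hbetween
    obtain ⟨xy, hxy, rfl⟩ := Multiset.mem_map.1 hc
    rcases le_or_gt (xy.1 f) τ with h | h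
    · exact (hmax xy ⟨hxy, h⟩).not_gt hbetween.1
    · exact (hmin xy ⟨hxy, h⟩).not_gt hbetween.2
  · simpa only [not_le] using (hside xy hxy).not

/-- Every tree of depth at most `d` is matched by a single leaf or by a midpoint split
with optimal subtrees. -/
lemma leafScore_le_errors_or_exists_midpoint (D : Multiset ((Fin p → ℝ) × Y)) (d : ℕ)
    (t : DTree p Y) (ht : t.depth ≤ d) :
    leafScore D ≤ errors t D ∨ ∃ (f : Fin p) (τ : ℝ), τ ∈ midpoints D f ∧
      theta (dle D f τ) (d - 1) + theta (dgt D f τ) (d - 1) ≤ errors t D := by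
  induction t with
  | leaf lab => exact Or.inl (leafScore_le_errors_leaf lab D)
  | node f τ l r ihl ihr =>
    simp only [DTree.depth] at ht
    rw [errors_node]
    by_cases hle : ∃ xy ∈ D, xy.1 f ≤ τ
    · by_cases hgt : ∃ xy ∈ D, τ < xy.1 f
      · obtain ⟨m, hm, h₁, h₂⟩ := exists_midpoint_split_eq hle hgt
        refine Or.inr ⟨f, m, hm, ?_⟩
        rw [h₁, h₂]
        exact add_le_add (theta_le_errors (by omega)) (theta_le_errors (by omega))
      · push Not at hgt
        rw [show dle D f τ = D from Multiset.filter_eq_self.2 hgt,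
          show dgt D f τ = 0 from Multiset.filter_eq_nil.2 fun xy h => (hgt xy h).not_gt]
        simpa [errors] using ihl (by omega)
    · push Not at hle
      rw [show dgt D f τ = D from Multiset.filter_eq_self.2 hle,
        show dle D f τ = 0 from Multiset.filter_eq_nil.2 fun xy h => (hle xy h).not_ge]
      simpa [errors] using ihr (by omega)

end

/-- Correctness of the dynamic programming recursion over midpoint thresholds
(Eqs. 4–6): for `d ≥ 1`, `θ(D, d)` equals the minimum of the best leaf score
`L(D)` and the split scores `θ(D(f ≤ τ), d−1) + θ(D(f > τ), d−1)` over all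
features `f` and midpoint thresholds `τ ∈ S^f`. -/
theorem dp_recursion_correct {p : ℕ} {Y : Type} [Fintype Y] [Nonempty Y]
    (D : Multiset ((Fin p → ℝ) × Y)) (d : ℕ) (hd : 1 ≤ d) :
    theta D d = sInf ({leafScore D} ∪
      {n | ∃ (f : Fin p) (τ : ℝ), τ ∈ midpoints D f ∧
        n = theta (dle D f τ) (d - 1) + theta (dgt D f τ) (d - 1)}) := by
  refine le_antisymm (le_csInf ⟨_, Or.inl rfl⟩ ?_) ?_
  · rintro n (rfl | ⟨f, τ, -, rfl⟩)
    · obtain ⟨lab, h⟩ := exists_errors_leaf_eq_leafScore D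
      exact h ▸ theta_le_errors (Nat.zero_le d)
    · obtain ⟨l, hl, hl'⟩ := exists_errors_eq_theta (dle D f τ) (d - 1)
      obtain ⟨r, hr, hr'⟩ := exists_errors_eq_theta (dgt D f τ) (d - 1)
      rw [← hl', ← hr', ← errors_node]
      exact theta_le_errors (by simp only [DTree.depth]; omega)
  · obtain ⟨t, ht, h⟩ := exists_errors_eq_theta D d
    rw [← h]
    rcases leafScore_le_errors_or_exists_midpoint D d t ht with hleaf | ⟨f, τ, hτ, hsplit⟩
    · exact (Nat.sInf_le (Or.inl rfl)).trans hleaf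
    · exact (Nat.sInf_le (Or.inr ⟨f, τ, hτ, rfl⟩)).trans hsplit
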